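/- Soundness and completeness of the emptiness algorithm: for every type expression E, etype(E) returns true if and only if ⟦E⟧ = ∅. -/

import Mathlib

inductive Tm (F : Type) : Type
  | app : F → List (Tm F) → Tm F

inductive TE (C : Type) : Type
  | top : TE C
  | bot : TE C
  | con : C → List (TE C) → TE C
  | and : TE C → TE C → TE C
  | or : TE C → TE C → TE C
  | not : TE C → TE C

inductive Arg (C : Type) : Type
  | param : ℕ → Arg C
  | con : C → List ℕ → Arg C

structure Rule (C F : Type) where
  c : C
  f : F
  args : List (Arg C)

def substArg {C : Type} (a : Arg C) (Es : List (TE C)) : TE C :=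
  match a with
  | .param i => Es.getD i .top
  | .con d is => .con d (is.map fun i => Es.getD i .top)

def mem {C F : Type} (Δ : List (Rule C F)) : Tm F → TE C → Prop
  | _, .top => True
  | _, .bot => False
  | t, .and a b => mem Δ t a ∧ mem Δ t b
  | t, .or a b => mem Δ t a ∨ mem Δ t b
  | t, .not a => ¬ mem Δ t a
  | .app f ts, .con c Es =>
      ∃ r ∈ Δ, r.c = c ∧ r.f = f ∧ r.args.length = ts.length ∧
        ∀ p ∈ ts.zip (r.args.map (substArg · Es)), mem Δ p.1 p.2
  termination_by t E => (sizeOf t, sizeOf E)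
  decreasing_by
    all_goals simp_wf
    · exact Prod.Lex.right _ (by omega)
    · exact Prod.Lex.right _ (by omega)
    · exact Prod.Lex.right _ (by omega)
    · exact Prod.Lex.right _ (by omega)
    · exact Prod.Lex.right _ (by omega)
    · exact Prod.Lex.left _ _ (by
        have hmem : p.1 ∈ ts := (List.of_mem_zip (by assumption)).1
        have := List.sizeOf_lt_of_mem hmem
        omega)

inductive WF {F : Type} (ar : F → ℕ) : Tm F → Prop
  | app {f : F} {ts : List (Tm F)} :
      ts.length = ar f → (∀ t ∈ ts, WF ar t) → WF ar (.app f ts)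

/-- A type literal: a type atom with a polarity (`true` = positive). -/
abbrev Lit (C : Type) := Bool × TE C

/-- A conjunctive type expression, as its list of literals. -/
abbrev Conj (C : Type) := List (Lit C)

/-- `t` satisfies the literal `l`. -/
def litMem {C F : Type} (Δ : List (Rule C F)) (l : Lit C) (t : Tm F) : Prop :=
  match l.1 with
  | true => mem Δ t l.2
  | false => ¬ mem Δ t l.2

/-- `⟦C⟧` for a conjunctive type expression: the intersection of the denotations
of its literals. -/
def conjMem {C F : Type} (Δ : List (Rule C F)) (Cj : Conj C) (t : Tm F) : Prop :=
  ∀ l ∈ Cj, litMem Δ l t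

/-- Product of two DNFs (conjoining every pair of conjuncts). -/
def prodDnf {α : Type} (l₁ l₂ : List (List α)) : List (List α) :=
  l₁.flatMap fun c₁ => l₂.map fun c₂ => c₁ ++ c₂

/-- Disjunctive normal form of a type expression (with polarity `pol`;
`dnf E true` is `DNF(E)`, a list of conjunctive type expressions). -/
def dnf {C : Type} : TE C → Bool → List (Conj C)
  | .and a b, true => prodDnf (dnf a true) (dnf b true)
  | .and a b, false => dnf a false ++ dnf b false
  | .or a b, true => dnf a true ++ dnf b true
  | .or a b, false => prodDnf (dnf a false) (dnf b false)
  | .not a, pol => dnf a (!pol)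
  | .top, pol => [[(pol, .top)]]
  | .bot, pol => [[(pol, .bot)]]
  | .con c Es, pol => [[(pol, .con c Es)]]

/-- `pos(C)`: the positive type atoms of a conjunctive type expression. -/
def posC {C : Type} (Cj : Conj C) : List (TE C) :=
  (Cj.filter (·.1)).map (·.2)

/-- `neg(C)`: the complemented type atoms of a conjunctive type expression. -/
def negC {C : Type} (Cj : Conj C) : List (TE C) :=
  (Cj.filter fun l => !l.1).map (·.2)

/-- `A_α^f`: the list of argument sequences `⟨α₁,…,α_k⟩` of the ground rule
instances `α → f(α₁,…,α_k)` in `ground(Δ)` (including `⊤ → f(⊤,…,⊤)`). -/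
def Arules {C F : Type} [DecidableEq C] [DecidableEq F] (ar : F → ℕ)
    (Δ : List (Rule C F)) : TE C → F → List (List (TE C))
  | .con c Es, f =>
      (Δ.filter fun r => decide (r.c = c) && decide (r.f = f)).map
        fun r => r.args.map (substArg · Es)
  | .top, f => [List.replicate (ar f) .top]
  | _, _ => []

/-- `push(¬γ)` for a sequence `γ = ⟨E₁,…,E_k⟩`: the disjunction
`⋁_{l=1}^{k} ⟨⊤,…,⊤,¬E_l,⊤,…,⊤⟩` (for `k = 0`, i.e. `push(¬ε) = Λ`, the empty
disjunction). -/
def pushNegSeq {C : Type} (γ : List (TE C)) : List (List (TE C)) :=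
  (List.range γ.length).map fun l =>
    (List.range γ.length).map fun i => if i = l then TE.not (γ.getD l .top) else TE.top

/-- `B_C^f = (⋀_{ω∈pos(C)} ⋁A_ω^f) ∧ (⋀_{τ∈neg(C)} push(¬(⋁A_τ^f)))`, a
conjunction of disjunctions of sequences (the harmless conjunct `⋁A_⊤^f` realises
the convention that `C` contains at least one positive literal, `⟦⊤∧C⟧=⟦C⟧`). -/
def BCf {C F : Type} [DecidableEq C] [DecidableEq F] (ar : F → ℕ)
    (Δ : List (Rule C F)) (Cj : Conj C) (f : F) : List (List (List (TE C))) :=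
  (TE.top :: posC Cj).map (fun ω => Arules ar Δ ω f) ++
    (negC Cj).flatMap fun τ => (Arules ar Δ τ f).map pushNegSeq

/-- DNF of a conjunction of disjunctions: all ways of choosing one disjunct from
each conjunct (a choice is a conjunctive sequence expression `Γ`). -/
def listProd {α : Type} : List (List α) → List (List α)
  | [] => [[]]
  | l :: ls => l.flatMap fun x => (listProd ls).map (x :: ·)

/-- `Γ↓j`: the conjunction of the `j`-th components of the sequences of a
conjunctive sequence expression `Γ`. -/
def proj {C : Type} (Γ : List (List (TE C))) (j : ℕ) : TE C :=
  (Γ.map fun γ => γ.getD j .top).foldr .and .top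

/-- The defining equations of the tabulated emptiness algorithm
(`et` = etype, `ec` = etype_conj, `es` = eseq, `esc` = eseq_conj; the second
argument is the table `Ψ` of conjunctive type expressions):
* `etype(E,Ψ)` is the conjunction of `etype_conj(C,Ψ)` over `C ∈ DNF(E)`;
* `etype_conj(C,Ψ)` is true if `pos(C) ∩ neg(C) ≠ ∅`, or if some `C' ∈ Ψ`
  subsumes `C` (`lit(C) ⊇ lit(C')`), and otherwise is the conjunction of
  `eseq(B_C^f, Ψ∪{C})` over the `f ∈ ⋂_{α∈pos(C)} F(α)`
  (`F(α) = {f | A_α^f ≠ ∅}`);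
* `eseq(Θ,Ψ)` is the conjunction of `eseq_conj(Γ,Ψ)` over `Γ ∈ DNF(Θ)`;
* `eseq_conj(Γ,Ψ)` of dimension `n ≥ 1` holds iff `etype(Γ↓j,Ψ)` for some
  `1 ≤ j ≤ n`; in dimension `0` it holds iff `Λ ∈ Γ` — in this encoding `Λ`
  (the empty disjunction) is absorbed by `listProd`, which then produces no `Γ`
  at all, so `eseq_conj` receives only `Λ`-free `Γ`'s and returns false in
  dimension `0`. -/
def AlgSpec {C F : Type} [DecidableEq C] [DecidableEq F] (ar : F → ℕ)
    (Δ : List (Rule C F))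
    (et : TE C → List (Conj C) → Prop)
    (ec : Conj C → List (Conj C) → Prop)
    (es : List (List (List (TE C))) → List (Conj C) → Prop)
    (esc : List (List (TE C)) → List (Conj C) → Prop) : Prop :=
  (∀ E Ψ, et E Ψ ↔ ∀ Cj ∈ dnf E true, ec Cj Ψ) ∧
  (∀ Cj Ψ, ec Cj Ψ ↔
      ((∃ E ∈ posC Cj, E ∈ negC Cj) ∨
       (∃ C' ∈ Ψ, ∀ l ∈ C', l ∈ Cj) ∨
       (∀ f : F, (∀ ω ∈ posC Cj, Arules ar Δ ω f ≠ []) →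
          es (BCf ar Δ Cj f) (Cj :: Ψ)))) ∧
  (∀ Θ Ψ, es Θ Ψ ↔ ∀ Γ ∈ listProd Θ, esc Γ Ψ) ∧
  (∀ Γ Ψ, esc Γ Ψ ↔ ∃ j < (Γ.headD []).length, et (proj Γ j) Ψ)

/-- A type expression that is a type atom: `⊤`, `⊥` or a constructor application. -/
def TE.IsTypeAtom {C : Type} : TE C → Prop
  | .top => True
  | .bot => True
  | .con _ _ => True
  | _ => False

/-- The type atoms at the leaves of the Boolean structure of the expression all lie in `U`. -/
def AtomsIn {C : Type} (U : Set (TE C)) : TE C → Prop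
  | .and a b => AtomsIn U a ∧ AtomsIn U b
  | .or a b => AtomsIn U a ∧ AtomsIn U b
  | .not a => AtomsIn U a
  | .top => .top ∈ U
  | .bot => .bot ∈ U
  | .con c Es => .con c Es ∈ U

/-- A set of type atoms that is stable under unfolding the type definitions. -/
structure AtomClosed {C F : Type} (Δ : List (Rule C F)) (U : Set (TE C)) : Prop where
  isAtom : ∀ x ∈ U, TE.IsTypeAtom x
  top_mem : TE.top ∈ U
  unfold : ∀ c Es, TE.con c Es ∈ U → ∀ r ∈ Δ, ∀ a ∈ r.args, AtomsIn U (substArg a Es)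

/-- A set of type expressions that is stable under taking immediate subexpressions. -/
structure SubClosed {C : Type} (S : Set (TE C)) : Prop where
  and : ∀ a b, TE.and a b ∈ S → a ∈ S ∧ b ∈ S
  or : ∀ a b, TE.or a b ∈ S → a ∈ S ∧ b ∈ S
  not : ∀ a, TE.not a ∈ S → a ∈ S
  con : ∀ c Es, TE.con c Es ∈ S → ∀ e ∈ Es, e ∈ S

theorem SubClosed.union {C : Type} {S T : Set (TE C)} (hS : SubClosed S) (hT : SubClosed T) :
    SubClosed (S ∪ T) where
  and a b h := h.elim (fun h => ⟨.inl (hS.and a b h).1, .inl (hS.and a b h).2⟩)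
    (fun h => ⟨.inr (hT.and a b h).1, .inr (hT.and a b h).2⟩)
  or a b h := h.elim (fun h => ⟨.inl (hS.or a b h).1, .inl (hS.or a b h).2⟩)
    (fun h => ⟨.inr (hT.or a b h).1, .inr (hT.or a b h).2⟩)
  not a h := h.imp (hS.not a) (hT.not a)
  con c Es h e he := h.imp (hS.con c Es · e he) (hT.con c Es · e he)

theorem exists_finite_subClosed {C : Type} (E : TE C) :
    ∃ S : Set (TE C), S.Finite ∧ SubClosed S ∧ E ∈ S := by
  refine TE.rec (motive_1 := fun E => ∃ S : Set (TE C), S.Finite ∧ SubClosed S ∧ E ∈ S)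
    (motive_2 := fun Es => ∃ S : Set (TE C), S.Finite ∧ SubClosed S ∧ ∀ E ∈ Es, E ∈ S)
    ?_ ?_ ?_ ?_ ?_ ?_ ?_ ?_ E
  · exact ⟨{.top}, Set.finite_singleton _, by constructor <;> simp, rfl⟩
  · exact ⟨{.bot}, Set.finite_singleton _, by constructor <;> simp, rfl⟩
  · rintro c Es ⟨S, hf, hS, hE⟩
    refine ⟨insert (.con c Es) S, hf.insert _, ?_, .inl rfl⟩
    constructor
    · rintro a b (h | h)
      · cases h
      · exact ⟨.inr (hS.and a b h).1, .inr (hS.and a b h).2⟩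
    · rintro a b (h | h)
      · cases h
      · exact ⟨.inr (hS.or a b h).1, .inr (hS.or a b h).2⟩
    · rintro a (h | h)
      · cases h
      · exact .inr (hS.not a h)
    · rintro c' Es' (h | h) e he
      · cases h
        exact .inr (hE e he)
      · exact .inr (hS.con c' Es' h e he)
  · rintro a b ⟨S, hf, hS, ha⟩ ⟨T, hf', hT, hb⟩
    have h := hS.union hT
    refine ⟨insert (.and a b) (S ∪ T), (hf.union hf').insert _, ?_, .inl rfl⟩
    constructor
    · rintro a' b' (h' | h')
      · cases h'
        exact ⟨.inr (.inl ha), .inr (.inr hb)⟩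
      · exact ⟨.inr (h.and _ _ h').1, .inr (h.and _ _ h').2⟩
    · rintro a' b' (h' | h')
      · cases h'
      · exact ⟨.inr (h.or _ _ h').1, .inr (h.or _ _ h').2⟩
    · rintro a' (h' | h')
      · cases h'
      · exact .inr (h.not _ h')
    · rintro c' Es' (h' | h') e he
      · cases h'
      · exact .inr (h.con _ _ h' e he)
  · rintro a b ⟨S, hf, hS, ha⟩ ⟨T, hf', hT, hb⟩
    have h := hS.union hT
    refine ⟨insert (.or a b) (S ∪ T), (hf.union hf').insert _, ?_, .inl rfl⟩
    constructor
    · rintro a' b' (h' | h')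
      · cases h'
      · exact ⟨.inr (h.and _ _ h').1, .inr (h.and _ _ h').2⟩
    · rintro a' b' (h' | h')
      · cases h'
        exact ⟨.inr (.inl ha), .inr (.inr hb)⟩
      · exact ⟨.inr (h.or _ _ h').1, .inr (h.or _ _ h').2⟩
    · rintro a' (h' | h')
      · cases h'
      · exact .inr (h.not _ h')
    · rintro c' Es' (h' | h') e he
      · cases h'
      · exact .inr (h.con _ _ h' e he)
  · rintro a ⟨S, hf, h, ha⟩
    refine ⟨insert (.not a) S, hf.insert _, ?_, .inl rfl⟩
    constructor
    · rintro a' b' (h' | h')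
      · cases h'
      · exact ⟨.inr (h.and _ _ h').1, .inr (h.and _ _ h').2⟩
    · rintro a' b' (h' | h')
      · cases h'
      · exact ⟨.inr (h.or _ _ h').1, .inr (h.or _ _ h').2⟩
    · rintro a' (h' | h')
      · cases h'
        exact .inr ha
      · exact .inr (h.not _ h')
    · rintro c' Es' (h' | h') e he
      · cases h'
      · exact .inr (h.con _ _ h' e he)
  · exact ⟨∅, Set.finite_empty, by constructor <;> simp, by simp⟩
  · rintro e Es ⟨S, hf, hS, he⟩ ⟨T, hf', hT, hE⟩
    refine ⟨S ∪ T, hf.union hf', hS.union hT, ?_⟩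
    intro x hx
    rcases List.mem_cons.1 hx with rfl | hx
    · exact .inl he
    · exact .inr (hE x hx)

theorem SubClosed.atomsIn {C : Type} {S U : Set (TE C)} (hS : SubClosed S)
    (hU : ∀ x ∈ S, TE.IsTypeAtom x → x ∈ U) : ∀ E ∈ S, AtomsIn U E
  | .top, h => hU _ h trivial
  | .bot, h => hU _ h trivial
  | .con _ _, h => hU _ h trivial
  | .and a b, h => ⟨hS.atomsIn hU a (hS.and a b h).1, hS.atomsIn hU b (hS.and a b h).2⟩
  | .or a b, h => ⟨hS.atomsIn hU a (hS.or a b h).1, hS.atomsIn hU b (hS.or a b h).2⟩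
  | .not a, h => hS.atomsIn hU a (hS.not a h)

theorem getD_mem_of_forall {α : Type} {S : Set α} {l : List α} {d : α} (hd : d ∈ S)
    (hl : ∀ x ∈ l, x ∈ S) (i : ℕ) : l.getD i d ∈ S := by
  rcases lt_or_ge i l.length with h | h
  · rw [List.getD_eq_getElem _ _ h]
    exact hl _ (List.getElem_mem h)
  · rwa [List.getD_eq_default _ _ h]

theorem finite_lists_of_finite {α : Type} {S : Set α} (hS : S.Finite) (N : ℕ) :
    {L : List α | L.length ≤ N ∧ ∀ e ∈ L, e ∈ S}.Finite := by
  have : Finite S := hS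
  refine ((List.finite_length_le S N).image (List.map Subtype.val)).subset ?_
  rintro L ⟨hL, hLS⟩
  lift L to List S using hLS
  exact ⟨L, by simpa using hL, rfl⟩

/-- The number of parameters occurring in an argument of a type definition. -/
def Arg.width {C : Type} : Arg C → ℕ
  | .param _ => 0
  | .con _ is => is.length

theorem exists_finite_atomClosed {C F : Type} [Finite C] (Δ : List (Rule C F)) (E : TE C) :
    ∃ U : Set (TE C), U.Finite ∧ AtomClosed Δ U ∧ AtomsIn U E := by
  obtain ⟨S₀, hf₀, hS₀, hE₀⟩ := exists_finite_subClosed E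
  obtain ⟨S₁, hf₁, hS₁, htop₁⟩ := exists_finite_subClosed (TE.top : TE C)
  obtain ⟨S, hf, hS, hE, htop⟩ : ∃ S : Set (TE C), S.Finite ∧ SubClosed S ∧ E ∈ S ∧ .top ∈ S :=
    ⟨S₀ ∪ S₁, hf₀.union hf₁, hS₀.union hS₁, .inl hE₀, .inr htop₁⟩
  obtain ⟨N, hN⟩ : ∃ N, ∀ r ∈ Δ, ∀ a ∈ r.args, a.width ≤ N := by
    have hfin : {a : Arg C | ∃ r ∈ Δ, a ∈ r.args}.Finite := by
      have h := (Δ.flatMap Rule.args).finite_toSet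
      simpa using h
    obtain ⟨N, hN⟩ := (hfin.image Arg.width).bddAbove
    exact ⟨N, fun r hr a ha => hN ⟨a, ⟨r, hr, ha⟩, rfl⟩⟩
  let T : Set (List (TE C)) := {L | L.length ≤ N ∧ ∀ e ∈ L, e ∈ S}
  let U : Set (TE C) := {x | TE.IsTypeAtom x ∧ (x ∈ S ∨ ∃ d, ∃ L ∈ T, x = .con d L)}
  have hSU : ∀ E ∈ S, AtomsIn U E := hS.atomsIn fun x hx hx' => ⟨hx', .inl hx⟩
  refine ⟨U, ?_, ⟨fun x hx => hx.1, ⟨trivial, .inl htop⟩, ?_⟩, hSU E hE⟩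
  · have hT : T.Finite := finite_lists_of_finite hf N
    refine (hf.union (Set.Finite.image2 (fun d L => TE.con d L) Set.finite_univ hT)).subset ?_
    rintro x ⟨-, h | ⟨d, L, hL, rfl⟩⟩
    · exact .inl h
    · exact .inr ⟨d, trivial, L, hL, rfl⟩
  · rintro c Es ⟨-, h⟩ r hr a ha
    have hEs : ∀ e ∈ Es, e ∈ S := by
      rcases h with h | ⟨d, L, hL, h⟩
      · exact hS.con c Es h
      · cases h
        exact hL.2
    have hw := hN r hr a ha
    cases a with
    | param i => exact hSU _ (getD_mem_of_forall htop hEs i)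
    | con d is =>
      refine ⟨trivial, .inr ⟨d, _, ⟨by simpa [Arg.width] using hw, ?_⟩, rfl⟩⟩
      intro e he
      obtain ⟨i, -, rfl⟩ := List.mem_map.1 he
      exact getD_mem_of_forall htop hEs i

theorem exists_mem_prodDnf {α : Type} {P : α → Prop} {l₁ l₂ : List (List α)} :
    (∃ c ∈ prodDnf l₁ l₂, ∀ x ∈ c, P x) ↔
      (∃ c ∈ l₁, ∀ x ∈ c, P x) ∧ ∃ c ∈ l₂, ∀ x ∈ c, P x := by
  constructor
  · rintro ⟨c, hc, h⟩
    simp only [prodDnf, List.mem_flatMap, List.mem_map] at hc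
    obtain ⟨c₁, h₁, c₂, h₂, rfl⟩ := hc
    exact ⟨⟨c₁, h₁, fun x hx => h x (List.mem_append_left _ hx)⟩,
      c₂, h₂, fun x hx => h x (List.mem_append_right _ hx)⟩
  · rintro ⟨⟨c₁, h₁, h₁'⟩, c₂, h₂, h₂'⟩
    refine ⟨c₁ ++ c₂, ?_, fun x hx => (List.mem_append.1 hx).elim (h₁' x) (h₂' x)⟩
    simp only [prodDnf, List.mem_flatMap, List.mem_map]
    exact ⟨c₁, h₁, c₂, h₂, rfl⟩

theorem forall_mem_prodDnf {α : Type} {P : α → Prop} {l₁ l₂ : List (List α)}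
    (h₁ : ∀ c ∈ l₁, ∀ x ∈ c, P x) (h₂ : ∀ c ∈ l₂, ∀ x ∈ c, P x) :
    ∀ c ∈ prodDnf l₁ l₂, ∀ x ∈ c, P x := by
  intro c hc x hx
  simp only [prodDnf, List.mem_flatMap, List.mem_map] at hc
  obtain ⟨c₁, hc₁, c₂, hc₂, rfl⟩ := hc
  exact (List.mem_append.1 hx).elim (h₁ _ hc₁ x) (h₂ _ hc₂ x)

theorem exists_mem_dnf {C F : Type} (Δ : List (Rule C F)) (t : Tm F) (E : TE C) (b : Bool) :
    (∃ Cj ∈ dnf E b, conjMem Δ Cj t) ↔ litMem Δ (b, E) t := by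
  have happ : ∀ l₁ l₂ : List (Conj C), (∃ Cj ∈ l₁ ++ l₂, conjMem Δ Cj t) ↔
      (∃ Cj ∈ l₁, conjMem Δ Cj t) ∨ ∃ Cj ∈ l₂, conjMem Δ Cj t := by
    intro l₁ l₂
    simp only [List.mem_append, or_and_right, exists_or]
  have hprod : ∀ l₁ l₂ : List (Conj C), (∃ Cj ∈ prodDnf l₁ l₂, conjMem Δ Cj t) ↔
      (∃ Cj ∈ l₁, conjMem Δ Cj t) ∧ ∃ Cj ∈ l₂, conjMem Δ Cj t :=
    fun _ _ => exists_mem_prodDnf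
  match E, b with
  | .and a b, true =>
    rw [dnf, hprod, exists_mem_dnf Δ t a, exists_mem_dnf Δ t b]
    simp [litMem, mem]
  | .and a b, false =>
    rw [dnf, happ, exists_mem_dnf Δ t a, exists_mem_dnf Δ t b]
    simp only [litMem, mem]
    tauto
  | .or a b, true =>
    rw [dnf, happ, exists_mem_dnf Δ t a, exists_mem_dnf Δ t b]
    simp [litMem, mem]
  | .or a b, false =>
    rw [dnf, hprod, exists_mem_dnf Δ t a, exists_mem_dnf Δ t b]
    simp only [litMem, mem]
    tauto
  | .not a, true =>
    rw [dnf, exists_mem_dnf Δ t a]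
    simp [litMem, mem]
  | .not a, false =>
    rw [dnf, exists_mem_dnf Δ t a]
    simp [litMem, mem]
  | .top, b => simp only [dnf, conjMem, List.mem_singleton, exists_eq_left, forall_eq]
  | .bot, b => simp only [dnf, conjMem, List.mem_singleton, exists_eq_left, forall_eq]
  | .con c Es, b => simp only [dnf, conjMem, List.mem_singleton, exists_eq_left, forall_eq]

theorem AtomsIn.dnf {C : Type} {U : Set (TE C)} : ∀ (E : TE C) (b : Bool), AtomsIn U E →
    ∀ Cj ∈ dnf E b, ∀ l ∈ Cj, l.2 ∈ U
  | .and a b, true, h => forall_mem_prodDnf (AtomsIn.dnf a _ h.1) (AtomsIn.dnf b _ h.2)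
  | .and a b, false, h => fun Cj hC => (List.mem_append.1 hC).elim
      (AtomsIn.dnf a _ h.1 Cj) (AtomsIn.dnf b _ h.2 Cj)
  | .or a b, true, h => fun Cj hC => (List.mem_append.1 hC).elim
      (AtomsIn.dnf a _ h.1 Cj) (AtomsIn.dnf b _ h.2 Cj)
  | .or a b, false, h => forall_mem_prodDnf (AtomsIn.dnf a _ h.1) (AtomsIn.dnf b _ h.2)
  | .not a, b, h => AtomsIn.dnf a (!b) h
  | .top, b, h => by
    simpa only [_root_.dnf, AtomsIn, List.mem_singleton, forall_eq] using h
  | .bot, b, h => by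
    simpa only [_root_.dnf, AtomsIn, List.mem_singleton, forall_eq] using h
  | .con c Es, b, h => by
    simpa only [_root_.dnf, AtomsIn, List.mem_singleton, forall_eq] using h

theorem exists_mem_listProd {α : Type} {P : α → Prop} {ls : List (List α)} :
    (∃ Γ ∈ listProd ls, ∀ γ ∈ Γ, P γ) ↔ ∀ l ∈ ls, ∃ γ ∈ l, P γ := by
  induction ls with
  | nil => simp [listProd]
  | cons l ls ih =>
    rw [List.forall_mem_cons, ← ih]
    constructor
    · rintro ⟨Γ, hΓ, h⟩
      simp only [listProd, List.mem_flatMap, List.mem_map] at hΓ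
      obtain ⟨x, hx, Γ', hΓ', rfl⟩ := hΓ
      rw [List.forall_mem_cons] at h
      exact ⟨⟨x, hx, h.1⟩, Γ', hΓ', h.2⟩
    · rintro ⟨⟨x, hx, h₁⟩, Γ', hΓ', h₂⟩
      refine ⟨x :: Γ', ?_, List.forall_mem_cons.2 ⟨h₁, h₂⟩⟩
      simp only [listProd, List.mem_flatMap, List.mem_map]
      exact ⟨x, hx, Γ', hΓ', rfl⟩

theorem forall_mem_listProd {α : Type} {P : α → Prop} {ls : List (List α)}
    (h : ∀ l ∈ ls, ∀ γ ∈ l, P γ) : ∀ Γ ∈ listProd ls, ∀ γ ∈ Γ, P γ := by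
  induction ls with
  | nil => simp [listProd]
  | cons l ls ih =>
    intro Γ hΓ
    simp only [listProd, List.mem_flatMap, List.mem_map] at hΓ
    obtain ⟨x, hx, Γ', hΓ', rfl⟩ := hΓ
    rw [List.forall_mem_cons] at h ⊢
    exact ⟨h.1 x hx, ih h.2 Γ' hΓ'⟩

theorem forall₂_iff_getD {α β : Type} {R : α → β → Prop} {ts : List α} {γ : List β} {d : β}
    (h : ts.length = γ.length) :
    List.Forall₂ R ts γ ↔ ∀ (j : ℕ) (hj : j < ts.length), R ts[j] (γ.getD j d) := by
  rw [List.forall₂_iff_get]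
  constructor
  · rintro ⟨-, h'⟩ j hj
    have hj' : j < γ.length := h ▸ hj
    rw [List.getD_eq_getElem _ _ hj']
    exact h' j hj hj'
  · intro h'
    refine ⟨h, fun j hj hj' => ?_⟩
    have := h' j hj
    rwa [List.getD_eq_getElem _ _ hj'] at this

theorem mem_app_iff {C F : Type} [DecidableEq C] [DecidableEq F] (ar : F → ℕ)
    (Δ : List (Rule C F)) {f : F} {ts : List (Tm F)} (hts : ts.length = ar f)
    {α : TE C} (hα : TE.IsTypeAtom α) :
    mem Δ (.app f ts) α ↔ ∃ γ ∈ Arules ar Δ α f, List.Forall₂ (mem Δ) ts γ := by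
  cases α with
  | top =>
    simp only [mem, Arules, List.mem_singleton, exists_eq_left, true_iff]
    rw [forall₂_iff_getD (d := .top) (by simpa using hts)]
    intro j hj
    rw [List.getD_replicate _ (by omega)]
    simp [mem]
  | bot => simp [mem, Arules]
  | con c Es =>
    simp only [mem, Arules, List.mem_map, List.mem_filter, Bool.and_eq_true, decide_eq_true_eq]
    constructor
    · rintro ⟨r, hr, hc, hf, hl, h⟩
      refine ⟨_, ⟨r, ⟨hr, hc, hf⟩, rfl⟩, List.forall₂_iff_zip.2 ⟨by simp [hl], ?_⟩⟩
      intro a b hab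
      exact h (a, b) hab
    · rintro ⟨_, ⟨r, ⟨hr, hc, hf⟩, rfl⟩, h⟩
      obtain ⟨hl, h⟩ := List.forall₂_iff_zip.1 h
      exact ⟨r, hr, hc, hf, by simpa using hl.symm, fun p hp => h hp⟩
  | and a b => exact hα.elim
  | or a b => exact hα.elim
  | not a => exact hα.elim

theorem exists_mem_pushNegSeq {C F : Type} (Δ : List (Rule C F)) {ts : List (Tm F)}
    {γ : List (TE C)} (h : ts.length = γ.length) :
    (∃ δ ∈ pushNegSeq γ, List.Forall₂ (mem Δ) ts δ) ↔ ¬ List.Forall₂ (mem Δ) ts γ := by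
  rw [forall₂_iff_getD (d := .top) h]
  push Not
  simp only [pushNegSeq, List.mem_map, List.mem_range, exists_exists_and_eq_and]
  constructor
  · rintro ⟨l, hl, hδ⟩
    rw [forall₂_iff_getD (d := .top) (by simpa using h)] at hδ
    have := hδ l (by omega)
    rw [List.getD_eq_getElem _ _ (by simpa using hl)] at this
    exact ⟨l, by omega, by simpa [mem] using this⟩
  · rintro ⟨l, hl, hn⟩
    refine ⟨l, by omega, ?_⟩
    rw [forall₂_iff_getD (d := .top) (by simpa using h)]
    intro j hj
    rw [List.getD_eq_getElem _ _ (by simpa using h ▸ hj)]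
    by_cases hjl : j = l
    · subst hjl
      simpa [mem] using hn
    · simp [mem, hjl]

theorem mem_posC {C : Type} {Cj : Conj C} {E : TE C} : E ∈ posC Cj ↔ (true, E) ∈ Cj := by
  simp [posC]

theorem mem_negC {C : Type} {Cj : Conj C} {E : TE C} : E ∈ negC Cj ↔ (false, E) ∈ Cj := by
  simp [negC]

theorem conjMem_iff {C F : Type} (Δ : List (Rule C F)) (Cj : Conj C) (t : Tm F) :
    conjMem Δ Cj t ↔ (∀ E ∈ posC Cj, mem Δ t E) ∧ ∀ E ∈ negC Cj, ¬ mem Δ t E := by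
  simp only [mem_posC, mem_negC, conjMem]
  constructor
  · intro h
    exact ⟨fun E hE => h _ hE, fun E hE => h _ hE⟩
  · rintro ⟨h₁, h₂⟩ ⟨_ | _, E⟩ hE
    · exact h₂ E hE
    · exact h₁ E hE

theorem length_of_mem_Arules {C F : Type} [DecidableEq C] [DecidableEq F] {ar : F → ℕ}
    {Δ : List (Rule C F)} (harity : ∀ r ∈ Δ, r.args.length = ar r.f) {α : TE C} {f : F}
    {γ : List (TE C)} (h : γ ∈ Arules ar Δ α f) : γ.length = ar f := by
  cases α <;> simp only [Arules, List.mem_singleton, List.mem_map, List.mem_filter,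
    Bool.and_eq_true, decide_eq_true_eq, List.not_mem_nil] at h
  · simp [h]
  · obtain ⟨r, ⟨hr, -, rfl⟩, rfl⟩ := h
    simpa using harity r hr

theorem length_of_mem_pushNegSeq {C : Type} {γ δ : List (TE C)} (h : δ ∈ pushNegSeq γ) :
    δ.length = γ.length := by
  simp only [pushNegSeq, List.mem_map] at h
  obtain ⟨l, -, rfl⟩ := h
  simp

theorem forall_mem_BCf {C F : Type} [DecidableEq C] [DecidableEq F] {ar : F → ℕ}
    {Δ : List (Rule C F)} {Cj : Conj C} {f : F} {P : List (List (TE C)) → Prop} :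
    (∀ l ∈ BCf ar Δ Cj f, P l) ↔ P (Arules ar Δ .top f) ∧
      (∀ ω ∈ posC Cj, P (Arules ar Δ ω f)) ∧
      ∀ τ ∈ negC Cj, ∀ γ ∈ Arules ar Δ τ f, P (pushNegSeq γ) := by
  rw [BCf, List.forall_mem_append, List.map_cons, List.forall_mem_cons, List.forall_mem_map,
    and_assoc]
  simp only [List.mem_flatMap, List.mem_map]
  constructor
  · rintro ⟨h₁, h₂, h₃⟩
    exact ⟨h₁, h₂, fun τ hτ γ hγ => h₃ _ ⟨τ, hτ, γ, hγ, rfl⟩⟩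
  · rintro ⟨h₁, h₂, h₃⟩
    refine ⟨h₁, h₂, ?_⟩
    rintro _ ⟨τ, hτ, γ, hγ, rfl⟩
    exact h₃ τ hτ γ hγ

theorem conjMem_app_iff {C F : Type} [DecidableEq C] [DecidableEq F] {ar : F → ℕ}
    {Δ : List (Rule C F)} (harity : ∀ r ∈ Δ, r.args.length = ar r.f) {Cj : Conj C}
    (hC : ∀ l ∈ Cj, TE.IsTypeAtom l.2) {f : F} {ts : List (Tm F)} (hts : ts.length = ar f) :
    conjMem Δ Cj (.app f ts) ↔
      ∃ Γ ∈ listProd (BCf ar Δ Cj f), ∀ γ ∈ Γ, List.Forall₂ (mem Δ) ts γ := by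
  rw [exists_mem_listProd, forall_mem_BCf, conjMem_iff,
    and_iff_right ((mem_app_iff ar Δ hts (α := .top) trivial).1 (by simp [mem]))]
  refine and_congr (forall₂_congr fun E hE => ?_) (forall₂_congr fun E hE => ?_)
  · exact mem_app_iff ar Δ hts (hC _ (mem_posC.1 hE))
  · rw [mem_app_iff ar Δ hts (hC _ (mem_negC.1 hE))]
    push Not
    refine forall₂_congr fun γ hγ => ?_
    rw [exists_mem_pushNegSeq Δ (hts.trans (length_of_mem_Arules harity hγ).symm)]

theorem length_of_mem_listProd_BCf {C F : Type} [DecidableEq C] [DecidableEq F] {ar : F → ℕ}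
    {Δ : List (Rule C F)} (harity : ∀ r ∈ Δ, r.args.length = ar r.f) {Cj : Conj C} {f : F} :
    ∀ Γ ∈ listProd (BCf ar Δ Cj f), ∀ γ ∈ Γ, γ.length = ar f := by
  refine forall_mem_listProd (forall_mem_BCf.2 ⟨?_, ?_, ?_⟩)
  · exact fun γ hγ => length_of_mem_Arules harity hγ
  · exact fun ω _ γ hγ => length_of_mem_Arules harity hγ
  · exact fun τ _ γ hγ δ hδ =>
      (length_of_mem_pushNegSeq hδ).trans (length_of_mem_Arules harity hγ)

theorem length_headD_of_mem_listProd_BCf {C F : Type} [DecidableEq C] [DecidableEq F] {ar : F → ℕ}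
    {Δ : List (Rule C F)} {Cj : Conj C} {f : F} {Γ : List (List (TE C))}
    (hΓ : Γ ∈ listProd (BCf ar Δ Cj f)) : (Γ.headD []).length = ar f := by
  simp only [BCf, List.map_cons, List.cons_append, listProd, Arules, List.mem_flatMap,
    List.mem_map, List.mem_singleton, exists_eq_left] at hΓ
  obtain ⟨Γ', -, rfl⟩ := hΓ
  simp

theorem mem_proj {C F : Type} (Δ : List (Rule C F)) (t : Tm F) (Γ : List (List (TE C))) (j : ℕ) :
    mem Δ t (proj Γ j) ↔ ∀ γ ∈ Γ, mem Δ t (γ.getD j .top) := by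
  unfold proj
  induction Γ with
  | nil => simp [mem]
  | cons γ Γ ih => simp only [List.map_cons, List.foldr_cons, mem, ih, List.forall_mem_cons]

theorem forall_forall₂_iff_proj {C F : Type} (Δ : List (Rule C F)) {ts : List (Tm F)}
    {Γ : List (List (TE C))} (h : ∀ γ ∈ Γ, γ.length = ts.length) :
    (∀ γ ∈ Γ, List.Forall₂ (mem Δ) ts γ) ↔
      ∀ (j : ℕ) (hj : j < ts.length), mem Δ ts[j] (proj Γ j) := by
  simp only [mem_proj]
  constructor
  · intro h' j hj γ hγ
    exact (forall₂_iff_getD (h γ hγ).symm).1 (h' γ hγ) j hj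
  · intro h' γ hγ
    exact (forall₂_iff_getD (h γ hγ).symm).2 fun j hj => h' j hj γ hγ

theorem AtomClosed.atomsIn_Arules {C F : Type} [DecidableEq C] [DecidableEq F] {ar : F → ℕ}
    {Δ : List (Rule C F)} {U : Set (TE C)} (hU : AtomClosed Δ U) {α : TE C} (hα : α ∈ U) {f : F} :
    ∀ γ ∈ Arules ar Δ α f, ∀ e ∈ γ, AtomsIn U e := by
  intro γ hγ e he
  cases α <;> simp only [Arules, List.mem_singleton, List.mem_map, List.mem_filter,
    Bool.and_eq_true, decide_eq_true_eq, List.not_mem_nil] at hγ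
  · subst hγ
    rw [List.eq_of_mem_replicate he]
    exact hU.top_mem
  · obtain ⟨r, ⟨hr, -, -⟩, rfl⟩ := hγ
    obtain ⟨a, ha, rfl⟩ := List.mem_map.1 he
    exact hU.unfold _ _ hα r hr a ha

theorem AtomClosed.atomsIn_proj {C F : Type} [DecidableEq C] [DecidableEq F] {ar : F → ℕ}
    {Δ : List (Rule C F)} {U : Set (TE C)} (hU : AtomClosed Δ U) {Cj : Conj C}
    (hC : ∀ l ∈ Cj, l.2 ∈ U) {f : F} {Γ : List (List (TE C))}
    (hΓ : Γ ∈ listProd (BCf ar Δ Cj f)) (j : ℕ) : AtomsIn U (proj Γ j) := by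
  have key : ∀ γ ∈ Γ, ∀ e ∈ γ, AtomsIn U e := by
    refine forall_mem_listProd (P := fun γ => ∀ e ∈ γ, AtomsIn U e) (forall_mem_BCf.2 ⟨?_, ?_, ?_⟩) Γ hΓ
    · exact hU.atomsIn_Arules hU.top_mem
    · exact fun ω hω => hU.atomsIn_Arules (hC _ (mem_posC.1 hω))
    · intro τ hτ γ hγ δ hδ e he
      have hγU := hU.atomsIn_Arules (hC _ (mem_negC.1 hτ)) γ hγ
      simp only [pushNegSeq, List.mem_map] at hδ
      obtain ⟨l, -, rfl⟩ := hδ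
      obtain ⟨i, -, rfl⟩ := List.mem_map.1 he
      split_ifs
      · exact getD_mem_of_forall (S := {e | AtomsIn U e}) hU.top_mem hγU l
      · exact hU.top_mem
  clear hΓ
  unfold proj
  induction Γ with
  | nil => exact hU.top_mem
  | cons γ Γ ih =>
    rw [List.forall_mem_cons] at key
    exact ⟨getD_mem_of_forall (S := {e | AtomsIn U e}) hU.top_mem key.1 j, ih key.2⟩

/-- If the algorithm accepts `Cj` relative to the table `Ψ` although `Cj` has a member `t`, then
some entry of the table has a member no larger than `t`. -/
theorem exists_table_member_of_accepted {C F : Type} [DecidableEq C] [DecidableEq F] {ar : F → ℕ}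
    {Δ : List (Rule C F)} (harity : ∀ r ∈ Δ, r.args.length = ar r.f)
    {et : TE C → List (Conj C) → Prop} {ec : Conj C → List (Conj C) → Prop}
    {es : List (List (List (TE C))) → List (Conj C) → Prop}
    {esc : List (List (TE C)) → List (Conj C) → Prop}
    (hspec : AlgSpec ar Δ et ec es esc) {U : Set (TE C)} (hU : AtomClosed Δ U) (n : ℕ) :
    ∀ (t : Tm F), sizeOf t ≤ n → WF ar t → ∀ (Cj : Conj C) (Ψ : List (Conj C)),
      (∀ l ∈ Cj, l.2 ∈ U) → ec Cj Ψ → conjMem Δ Cj t →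
      ∃ C' ∈ Ψ, ∃ t' : Tm F, sizeOf t' ≤ sizeOf t ∧ WF ar t' ∧ conjMem Δ C' t' := by
  obtain ⟨het, hec, hes, hesc⟩ := hspec
  induction n with
  | zero =>
    rintro ⟨f, ts⟩ ht
    simp at ht
  | succ n ih =>
    intro t hn ht Cj Ψ hC hacc hmem
    rcases (hec Cj Ψ).1 hacc with ⟨E, hp, hn⟩ | ⟨C', hC', hsub⟩ | hstep
    · exact absurd (hmem _ (mem_posC.1 hp)) (hmem _ (mem_negC.1 hn))
    · exact ⟨C', hC', t, le_rfl, ht, fun l hl => hmem l (hsub l hl)⟩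
    · obtain ⟨hlen, hts⟩ := ht
      rename_i f ts
      have hatom : ∀ l ∈ Cj, TE.IsTypeAtom l.2 := fun l hl => hU.isAtom _ (hC l hl)
      obtain ⟨Γ, hΓ, hΓts⟩ := (conjMem_app_iff harity hatom hlen).1 hmem
      have hF : ∀ ω ∈ posC Cj, Arules ar Δ ω f ≠ [] := by
        intro ω hω h
        obtain ⟨γ, hγ, -⟩ := (mem_app_iff ar Δ hlen (hatom _ (mem_posC.1 hω))).1
          (hmem _ (mem_posC.1 hω))
        simp [h] at hγ
      obtain ⟨j, hj, hetj⟩ := (hesc _ _).1 ((hes _ _).1 (hstep f hF) Γ hΓ)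
      rw [length_headD_of_mem_listProd_BCf hΓ, ← hlen] at hj
      have hproj := (forall_forall₂_iff_proj Δ fun γ hγ =>
        (length_of_mem_listProd_BCf harity Γ hΓ γ hγ).trans hlen.symm).1 hΓts j hj
      obtain ⟨D, hD, hDmem⟩ := (exists_mem_dnf Δ ts[j] (proj Γ j) true).2 hproj
      have hlt : sizeOf ts[j] < sizeOf (Tm.app f ts) := by
        have := List.sizeOf_lt_of_mem (List.getElem_mem hj)
        simp only [Tm.app.sizeOf_spec]
        omega
      obtain ⟨C', hC', t', hle, hwf, hmemC⟩ := ih ts[j] (by omega) (hts _ (List.getElem_mem hj)) D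
        (Cj :: Ψ) (AtomsIn.dnf _ _ (hU.atomsIn_proj hC hΓ j) D hD) ((het _ _).1 hetj D hD) hDmem
      rcases List.mem_cons.1 hC' with rfl | hC'
      · obtain ⟨C'', h₁, t'', h₂, h₃⟩ := ih t' (by omega) hwf C' Ψ hC hacc hmemC
        exact ⟨C'', h₁, t'', by omega, h₃⟩
      · exact ⟨C', hC', t', by omega, hwf, hmemC⟩

/-- The sets of literals over `U` that are not subsumed by the table `Ψ`. -/
def unsubsumed {C : Type} (U : Set (TE C)) (Ψ : List (Conj C)) : Set (Set (Lit C)) :=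
  {D | (∀ l ∈ D, l.2 ∈ U) ∧ ∀ C' ∈ Ψ, ¬ ∀ l ∈ C', l ∈ D}

theorem unsubsumed_finite {C : Type} {U : Set (TE C)} (hU : U.Finite) (Ψ : List (Conj C)) :
    (unsubsumed U Ψ).Finite := by
  have h : (Set.univ ×ˢ U : Set (Lit C)).Finite := Set.finite_univ.prod hU
  exact h.finite_subsets.subset fun D hD l hl => ⟨trivial, hD.1 l hl⟩

theorem ncard_unsubsumed_cons_lt {C : Type} {U : Set (TE C)} (hU : U.Finite) {Ψ : List (Conj C)}
    {Cj : Conj C} (hC : ∀ l ∈ Cj, l.2 ∈ U) (hΨ : ¬ ∃ C' ∈ Ψ, ∀ l ∈ C', l ∈ Cj) :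
    (unsubsumed U (Cj :: Ψ)).ncard < (unsubsumed U Ψ).ncard := by
  refine Set.ncard_lt_ncard ?_ (unsubsumed_finite hU Ψ)
  refine Set.ssubset_iff_of_subset ?_ |>.2 ⟨{l | l ∈ Cj}, ⟨hC, ?_⟩, ?_⟩
  · exact fun D hD => ⟨hD.1, fun C' hC' => hD.2 C' (List.mem_cons_of_mem _ hC')⟩
  · exact fun C' hC' h => hΨ ⟨C', hC', h⟩
  · exact fun h => h.2 Cj List.mem_cons_self fun l hl => hl

theorem exists_member_of_rejected {C F : Type} [DecidableEq C] [DecidableEq F] {ar : F → ℕ}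
    {Δ : List (Rule C F)} (harity : ∀ r ∈ Δ, r.args.length = ar r.f)
    {et : TE C → List (Conj C) → Prop} {ec : Conj C → List (Conj C) → Prop}
    {es : List (List (List (TE C))) → List (Conj C) → Prop}
    {esc : List (List (TE C)) → List (Conj C) → Prop}
    (hspec : AlgSpec ar Δ et ec es esc) {U : Set (TE C)} (hU : AtomClosed Δ U) (hfin : U.Finite)
    (n : ℕ) :
    ∀ (Cj : Conj C) (Ψ : List (Conj C)), (unsubsumed U Ψ).ncard ≤ n → (∀ l ∈ Cj, l.2 ∈ U) →
      ¬ ec Cj Ψ → ∃ t : Tm F, WF ar t ∧ conjMem Δ Cj t := by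
  obtain ⟨het, hec, hes, hesc⟩ := hspec
  induction n with
  | zero =>
    intro Cj Ψ hn hC hrej
    rw [hec, not_or, not_or] at hrej
    have := ncard_unsubsumed_cons_lt hfin hC hrej.2.1
    omega
  | succ n ih =>
    intro Cj Ψ hn hC hrej
    rw [hec, not_or, not_or] at hrej
    obtain ⟨-, hsub, hrej⟩ := hrej
    have hlt := ncard_unsubsumed_cons_lt hfin hC hsub
    push Not at hrej
    obtain ⟨f, -, hf⟩ := hrej
    rw [hes] at hf
    push Not at hf
    obtain ⟨Γ, hΓ, hf⟩ := hf
    rw [hesc, length_headD_of_mem_listProd_BCf hΓ] at hf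
    push Not at hf
    have hch : ∀ j : Fin (ar f), ∃ t : Tm F, WF ar t ∧ mem Δ t (proj Γ j) := by
      intro j
      have hj := hf j j.2
      rw [het] at hj
      push Not at hj
      obtain ⟨D, hD, hDrej⟩ := hj
      obtain ⟨t, ht, hmem⟩ := ih D (Cj :: Ψ) (by omega)
        (AtomsIn.dnf _ _ (hU.atomsIn_proj hC hΓ j) D hD) hDrej
      exact ⟨t, ht, (exists_mem_dnf Δ t (proj Γ j) true).1 ⟨D, hD, hmem⟩⟩
    choose g hg hgmem using hch
    have hlen : (List.ofFn g).length = ar f := List.length_ofFn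
    refine ⟨.app f (List.ofFn g), .app hlen ?_, ?_⟩
    · intro t ht
      obtain ⟨j, rfl⟩ := List.mem_ofFn.1 ht
      exact hg j
    · refine (conjMem_app_iff harity (fun l hl => hU.isAtom _ (hC l hl)) hlen).2 ⟨Γ, hΓ, ?_⟩
      refine (forall_forall₂_iff_proj Δ fun γ hγ =>
        (length_of_mem_listProd_BCf harity Γ hΓ γ hγ).trans hlen.symm).2 fun j hj => ?_
      rw [List.getElem_ofFn]
      exact hgmem ⟨j, hlen ▸ hj⟩

/-- Soundness and completeness of the emptiness algorithm: with
`Σ = F` finite (containing at least one constant), `Π = C` finite, `Δ` a finite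
simplified arity-respecting set of parametric type definitions, and
`et`, `ec`, `es`, `esc` the (unique) functions satisfying the defining equations
of the tabulated algorithm, for every type expression `E`,
`etype(E) = etype(E,∅)` returns true if and only if `⟦E⟧ = ∅`
(the denotation being taken in the set of ground — i.e. well-formed — terms
over `Σ`). -/
theorem algorithm_sound_and_complete {C F : Type} [DecidableEq C] [DecidableEq F]
    [Finite C] [Finite F] (ar : F → ℕ) (Δ : List (Rule C F))
    (harity : ∀ r ∈ Δ, r.args.length = ar r.f) (hconst : ∃ f : F, ar f = 0)
    (et : TE C → List (Conj C) → Prop) (ec : Conj C → List (Conj C) → Prop)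
    (es : List (List (List (TE C))) → List (Conj C) → Prop)
    (esc : List (List (TE C)) → List (Conj C) → Prop)
    (hspec : AlgSpec ar Δ et ec es esc) :
    ∀ E : TE C, et E [] ↔ {t : Tm F | WF ar t ∧ mem Δ t E} = ∅ := by
  intro E
  obtain ⟨U, hfin, hU, hE⟩ := exists_finite_atomClosed Δ E
  rw [hspec.1, Set.eq_empty_iff_forall_notMem]
  constructor
  · rintro h t ⟨hwf, hmem⟩
    obtain ⟨Cj, hCj, hC⟩ := (exists_mem_dnf Δ t E true).2 hmem
    obtain ⟨C', hC', -⟩ := exists_table_member_of_accepted harity hspec hU (sizeOf t) t le_rfl hwf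
      Cj [] (AtomsIn.dnf E true hE Cj hCj) (h Cj hCj) hC
    simp at hC'
  · intro h Cj hCj
    by_contra hrej
    obtain ⟨t, hwf, hC⟩ := exists_member_of_rejected harity hspec hU hfin _ Cj [] le_rfl
      (AtomsIn.dnf E true hE Cj hCj) hrej
    exact h t ⟨hwf, (exists_mem_dnf Δ t E true).1 ⟨Cj, hCj, hC⟩⟩
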